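/- arXiv:1802.09205 — 2 statements merged into one kernel-verified Lean document; each statement's English description precedes it below -/
import Mathlib

section
/- Let S be a finite set of points in a metric space, let k be a positive integer with k < |S|, and let X ⊆ S be a nonempty subset with k ≤ |X|. If T_X is the set of the first k points of a greedy (GMM) sequence in X, then r_{T_X}(X) ≤ 2 · r_k^*(S). -/
/-- Distance-based radius of a finite set `S` with respect to a finite set
of centers `T`: `r_T(S) = max_{s ∈ S} d(s, T)`. -/
noncomputable def radius {α : Type*} [MetricSpace α] (S T : Finset α) : ℝ :=
  sSup ((fun s => Metric.infDist s (T : Set α)) '' (S : Set α))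

/-- Optimal radius of the `k`-center problem on `S`. -/
noncomputable def optRadius {α : Type*} [MetricSpace α] (S : Finset α) (k : ℕ) : ℝ :=
  sInf ((fun T => radius S T) '' {T : Finset α | T ⊆ S ∧ T.card = k})

/-- Optimal radius of the `k`-center problem with `z` outliers on `S`. -/
noncomputable def optRadiusOut {α : Type*} [MetricSpace α] [DecidableEq α]
    (S : Finset α) (k z : ℕ) : ℝ :=
  sInf {r : ℝ | ∃ T Z : Finset α, T ⊆ S ∧ T.card = k ∧ Z ⊆ S ∧ Z.card = z ∧
    radius (S \ Z) T = r}

/-- `t : ℕ → α` is a greedy (GMM) sequence in the finite set `X`: `t 0 ∈ X` and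
each `t (j+1)` is a point of `X` at maximum distance from `{t 0, …, t j}`. -/
def IsGMM {α : Type*} [MetricSpace α] [DecidableEq α] (X : Finset α) (t : ℕ → α) : Prop :=
  t 0 ∈ X ∧ ∀ j : ℕ, t (j + 1) ∈ X ∧ ∀ x ∈ X,
    Metric.infDist x (((Finset.range (j + 1)).image t : Finset α) : Set α) ≤
      Metric.infDist (t (j + 1)) (((Finset.range (j + 1)).image t : Finset α) : Set α)

/-- A metric space has doubling dimension at most `D` if every closed ball of
radius `r` is covered by at most `2^D` closed balls of radius `r/2`. -/
def DoublingDimLE (α : Type*) [MetricSpace α] (D : ℕ) : Prop :=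
  ∀ (x : α) (r : ℝ), 0 < r → ∃ Y : Finset α, Y.card ≤ 2 ^ D ∧
    Metric.closedBall x r ⊆ ⋃ y ∈ Y, Metric.closedBall y (r / 2)

section Radius

variable {α : Type*} [MetricSpace α]

lemma infDist_le_radius (S T : Finset α) {s : α} (hs : s ∈ S) :
    Metric.infDist s (T : Set α) ≤ radius S T :=
  le_csSup (S.finite_toSet.image _).bddAbove (Set.mem_image_of_mem _ hs)

/-- Every point of `S` is within distance `radius S T` of some center in `T`. -/
lemma exists_dist_le_radius (S : Finset α) {T : Finset α} (hT : T.Nonempty) {s : α}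
    (hs : s ∈ S) : ∃ c ∈ T, dist s c ≤ radius S T := by
  obtain ⟨c, hc, hd⟩ := T.finite_toSet.isCompact.exists_infDist_eq_dist hT s
  exact ⟨c, hc, hd ▸ infDist_le_radius S T hs⟩

/-- Among more than `T.card` points of `S`, two are within distance `2 * radius S T`. -/
lemma exists_dist_le_two_mul_radius {S T : Finset α} (hT : T.Nonempty) {n : ℕ}
    (hn : T.card < n) {u : ℕ → α} (hu : ∀ i < n, u i ∈ S) :
    ∃ i j, i < j ∧ j < n ∧ dist (u i) (u j) ≤ 2 * radius S T := by
  have hc : ∀ i, ∃ c ∈ T, i < n → dist (u i) c ≤ radius S T := by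
    intro i
    by_cases hi : i < n
    · obtain ⟨c, hc, hd⟩ := exists_dist_le_radius S hT (hu i hi)
      exact ⟨c, hc, fun _ => hd⟩
    · exact ⟨hT.choose, hT.choose_spec, fun h => absurd h hi⟩
  choose c hcT hcd using hc
  obtain ⟨i, hi, j, hj, hij, hcij⟩ := Finset.exists_ne_map_eq_of_card_lt_of_maps_to
    (s := Finset.range n) (by simpa using hn) (fun i _ => hcT i)
  rw [Finset.mem_range] at hi hj
  have hdi := hcd i hi
  have hdj := hcd j hj
  rw [← hcij] at hdj
  have hd : dist (u i) (u j) ≤ 2 * radius S T := by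
    linarith [dist_triangle_right (u i) (u j) (c i)]
  rcases hij.lt_or_gt with h | h
  · exact ⟨i, j, h, hj, hd⟩
  · exact ⟨j, i, h, hi, dist_comm (u i) (u j) ▸ hd⟩

end Radius

section Greedy

variable {α : Type*} [MetricSpace α] [DecidableEq α] {X : Finset α} {t : ℕ → α}

lemma IsGMM.mem (ht : IsGMM X t) : ∀ i, t i ∈ X
  | 0 => ht.1
  | j + 1 => (ht.2 j).1

/-- The first `k` greedy points are pairwise at least as far apart as any point of `X` is from
them. -/
lemma IsGMM.infDist_le_dist (ht : IsGMM X t) {x : α} (hx : x ∈ X) {i j k : ℕ} (hij : i < j)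
    (hjk : j < k) :
    Metric.infDist x ((Finset.range k).image t : Finset α) ≤ dist (t i) (t j) := by
  obtain ⟨m, rfl⟩ : ∃ m, j = m + 1 := ⟨j - 1, by omega⟩
  have hi : t i ∈ (((Finset.range (m + 1)).image t : Finset α) : Set α) :=
    Finset.mem_coe.2 (Finset.mem_image_of_mem _ (Finset.mem_range.2 hij))
  calc Metric.infDist x ((Finset.range k).image t : Finset α)
      ≤ Metric.infDist x ((Finset.range (m + 1)).image t : Finset α) :=
        Metric.infDist_le_infDist_of_subset (Finset.coe_subset.2
          (Finset.image_subset_image (Finset.range_subset_range.2 hjk.le))) ⟨_, hi⟩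
    _ ≤ Metric.infDist (t (m + 1)) ((Finset.range (m + 1)).image t : Finset α) :=
        (ht.2 m).2 x hx
    _ ≤ dist (t (m + 1)) (t i) := Metric.infDist_le_dist_of_mem hi
    _ = dist (t i) (t (m + 1)) := dist_comm _ _

lemma IsGMM.infDist_le_two_mul_radius (ht : IsGMM X t) {S T : Finset α} (hXS : X ⊆ S)
    (hT : T.Nonempty) {x : α} (hx : x ∈ X) :
    Metric.infDist x ((Finset.range T.card).image t : Finset α) ≤ 2 * radius S T := by
  obtain ⟨i, j, hij, hj, hd⟩ := exists_dist_le_two_mul_radius (S := S) hT (Nat.lt_succ_self _)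
    (u := fun i => if i < T.card then t i else x) (fun i _ => by
      split_ifs
      exacts [hXS (ht.mem i), hXS hx])
  have hi : i < T.card := by omega
  refine le_trans ?_ hd
  simp only [hi, if_true]
  split_ifs with hjT
  · exact ht.infDist_le_dist hx hij hjT
  · rw [dist_comm]
    exact Metric.infDist_le_dist_of_mem
      (Finset.mem_coe.2 (Finset.mem_image_of_mem _ (Finset.mem_range.2 hi)))

end Greedy

/-- Lemma 2.1: running GMM for `k` steps on a subset `X ⊆ S`
yields a set of centers `T_X` with `r_{T_X}(X) ≤ 2 · r_k^*(S)`. -/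
theorem gmm_subset_two_approx {α : Type*} [MetricSpace α] [DecidableEq α]
    (S : Finset α) (k : ℕ) (hk : 0 < k) (hkS : k < S.card)
    (X : Finset α) (hXS : X ⊆ S) (hXne : X.Nonempty) (hkX : k ≤ X.card)
    (t : ℕ → α) (ht : IsGMM X t) :
    radius X ((Finset.range k).image t) ≤ 2 * optRadius S k := by
  refine csSup_le (hXne.to_set.image _) ?_
  rintro _ ⟨x, hx, rfl⟩
  obtain ⟨T₀, hT₀, hcard⟩ := Finset.exists_subset_card_eq hkS.le
  have hopt : Metric.infDist x ((Finset.range k).image t : Finset α) / 2 ≤ optRadius S k := by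
    refine le_csInf ⟨_, T₀, ⟨hT₀, hcard⟩, rfl⟩ ?_
    rintro _ ⟨T, ⟨-, rfl⟩, rfl⟩
    have := ht.infDist_le_two_mul_radius hXS (Finset.card_pos.1 hk) hx
    dsimp only
    linarith
  dsimp only
  linarith
end

section
/- Let M be a metric space of doubling dimension at most D, let X be a finite nonempty subset of M, let k, z be positive integers, and suppose there are k + z points c_1, ..., c_{k+z} of M and a radius R ≥ 0 such that every point of X is within distance R of some c_i. Let 0 < ε̂ ≤ 1, set h = (k + z) · 2^{D·⌈log₂(4/ε̂)⌉}, and let m = min(h, |X|). Then the set T^m consisting of the first m points of any greedy (GMM) sequence in X satisfies r_{T^m}(X) ≤ (ε̂/2) · R; hence the smallest index τ for which a greedy sequence prefix T^τ in X satisfies r_{T^τ}(X) ≤ (ε̂/2) · R is at most (k + z) · 2^{D·⌈log₂(4/ε̂)⌉}. -/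
/-- In a doubling space, closed balls of radius `r` are covered by `2 ^ (D * p)` closed balls
of radius `r / 2 ^ p`. -/
theorem DoublingDimLE.exists_cover {α : Type*} [MetricSpace α] [DecidableEq α] {D : ℕ}
    (hD : DoublingDimLE α D) {r : ℝ} (hr : 0 ≤ r) (x : α) (p : ℕ) :
    ∃ Y : Finset α, Y.card ≤ 2 ^ (D * p) ∧
      ∀ a, dist a x ≤ r → ∃ y ∈ Y, dist a y ≤ r / 2 ^ p := by
  rcases hr.eq_or_lt with rfl | hr
  · exact ⟨{x}, by simpa using Nat.one_le_two_pow, fun a ha => ⟨x, by simp, by simpa using ha⟩⟩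
  induction p with
  | zero => exact ⟨{x}, by simp, fun a ha => ⟨x, by simp, by simpa using ha⟩⟩
  | succ p ih =>
    obtain ⟨Y, hYcard, hY⟩ := ih
    choose f hfcard hf using fun y : α => hD y (r / 2 ^ p) (by positivity)
    refine ⟨Y.biUnion f, ?_, fun a ha => ?_⟩
    · calc (Y.biUnion f).card ≤ Y.card * 2 ^ D :=
            Finset.card_biUnion_le_card_mul _ _ _ fun y _ => hfcard y
        _ ≤ 2 ^ (D * p) * 2 ^ D := Nat.mul_le_mul_right _ hYcard
        _ = 2 ^ (D * (p + 1)) := by rw [← pow_add]; ring_nf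
    · obtain ⟨y, hy, hay⟩ := hY a ha
      have hmem := hf y (Metric.mem_closedBall.2 hay)
      simp only [Set.mem_iUnion, Metric.mem_closedBall] at hmem
      obtain ⟨w, hw, haw⟩ := hmem
      refine ⟨w, Finset.mem_biUnion.2 ⟨y, hy, hw⟩, haw.trans_eq ?_⟩
      rw [pow_succ, div_div]

theorem IsGMM.mem_s10 {α : Type*} [MetricSpace α] [DecidableEq α] {X : Finset α} {t : ℕ → α}
    (ht : IsGMM X t) : ∀ j, t j ∈ X
  | 0 => ht.1
  | j + 1 => (ht.2 j).1

/-- If some point of `X` is farther than `δ` from the first `m` points of a greedy sequence,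
then the first `m + 1` points of the sequence are pairwise farther than `δ` apart. -/
theorem IsGMM.lt_dist {α : Type*} [MetricSpace α] [DecidableEq α] {X : Finset α} {t : ℕ → α}
    (ht : IsGMM X t) {m : ℕ} {x : α} (hx : x ∈ X) {δ : ℝ}
    (hδ : δ < Metric.infDist x (((Finset.range m).image t : Finset α) : Set α))
    {i j : ℕ} (hij : i < j) (hjm : j ≤ m) : δ < dist (t j) (t i) := by
  obtain ⟨n, rfl⟩ := Nat.exists_eq_succ_of_ne_zero (Nat.ne_zero_of_lt hij)
  calc δ < Metric.infDist x (((Finset.range m).image t : Finset α) : Set α) := hδ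
    _ ≤ Metric.infDist x (((Finset.range (n + 1)).image t : Finset α) : Set α) := by
      refine Metric.infDist_le_infDist_of_subset ?_ ⟨t 0, by simpa using ⟨0, by simp⟩⟩
      exact_mod_cast Finset.image_subset_image (Finset.range_mono hjm)
    _ ≤ _ := (ht.2 n).2 x hx
    _ ≤ dist (t (n + 1)) (t i) :=
      Metric.infDist_le_dist_of_mem
        (Finset.mem_coe.2 (Finset.mem_image_of_mem t (Finset.mem_range.2 hij)))

/-- If `X` is covered by at most `h` closed balls of radius `δ / 2`, then the first
`min h |X|` points of a greedy sequence in `X` have radius at most `δ`. -/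
theorem IsGMM.radius_le {α : Type*} [MetricSpace α] [DecidableEq α] {X : Finset α} {t : ℕ → α}
    (ht : IsGMM X t) {δ : ℝ} (hδ : 0 ≤ δ) {Y : Finset α} {h : ℕ} (hYcard : Y.card ≤ h)
    (hY : ∀ x ∈ X, ∃ y ∈ Y, dist x y ≤ δ / 2) :
    radius X ((Finset.range (min h X.card)).image t) ≤ δ := by
  refine Real.sSup_le ?_ hδ
  rintro _ ⟨x, hx, rfl⟩
  by_contra! hlt
  have hsep {i j : ℕ} := ht.lt_dist (Finset.mem_coe.1 hx) hlt (i := i) (j := j)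
  rcases le_total h X.card with hle | hle
  · rw [min_eq_left hle] at hsep
    choose! f hfY hf using hY
    obtain ⟨i, hi, j, hj, hne, heq⟩ := Finset.exists_ne_map_eq_of_card_lt_of_maps_to
      (s := Finset.range (h + 1)) (t := Y) (f := fun i => f (t i))
      (by rw [Finset.card_range]; omega) (fun i _ => hfY _ (ht.mem_s10 i))
    wlog hij : i < j generalizing i j
    · exact this j hj i hi hne.symm heq.symm (by omega)
    have hdist := hsep hij (by simpa [Nat.lt_succ_iff] using hj)
    have hi' := hf _ (ht.mem_s10 i)
    have hj' := hf _ (ht.mem_s10 j)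
    have htri := dist_triangle_right (t j) (t i) (f (t j))
    rw [heq] at hi'
    linarith
  · rw [min_eq_right hle] at hsep
    obtain ⟨i, hi, j, hj, hne, heq⟩ := Finset.exists_ne_map_eq_of_card_lt_of_maps_to
      (s := Finset.range (X.card + 1)) (t := X) (f := t)
      (by simp) (fun i _ => ht.mem_s10 i)
    wlog hij : i < j generalizing i j
    · exact this j hj i hi hne.symm heq.symm (by omega)
    have hdist := hsep hij (by simpa [Nat.lt_succ_iff] using hj)
    rw [heq, dist_self] at hdist
    linarith

/-- Lemma 3.6: if `X` is covered by `k + z` balls of radius `R`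
in a space of doubling dimension at most `D`, then after
`m = min((k+z)·2^(D·⌈log₂(4/ε̂)⌉), |X|)` steps GMM achieves radius at most
`(ε̂/2)·R`; hence the smallest such prefix length is at most
`(k+z)·2^(D·⌈log₂(4/ε̂)⌉)`. -/
theorem gmm_coreset_size_outliers {α : Type*} [MetricSpace α] [DecidableEq α]
    (D : ℕ) (hD : DoublingDimLE α D)
    (X : Finset α) (hX : X.Nonempty)
    (k z : ℕ) (hk : 0 < k) (hz : 0 < z)
    (c : Fin (k + z) → α) (R : ℝ) (hR : 0 ≤ R)
    (hcov : ∀ x ∈ X, ∃ i : Fin (k + z), dist x (c i) ≤ R)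
    (εh : ℝ) (hεh : 0 < εh) (hεh1 : εh ≤ 1)
    (t : ℕ → α) (ht : IsGMM X t) :
    radius X
        ((Finset.range
          (min ((k + z) * 2 ^ (D * ⌈Real.logb 2 (4 / εh)⌉₊)) X.card)).image t)
      ≤ εh / 2 * R ∧
    ∃ τ ≤ (k + z) * 2 ^ (D * ⌈Real.logb 2 (4 / εh)⌉₊),
      radius X ((Finset.range τ).image t) ≤ εh / 2 * R := by
  set p := ⌈Real.logb 2 (4 / εh)⌉₊
  have hpow : 4 / εh ≤ 2 ^ p := by
    rw [← Real.rpow_natCast, ← Real.logb_le_iff_le_rpow (by norm_num) (by positivity)]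
    exact Nat.le_ceil _
  have hRp : R / 2 ^ p ≤ εh / 2 * R / 2 := by
    calc R / 2 ^ p ≤ R / (4 / εh) := by gcongr
      _ = εh / 2 * R / 2 := by field_simp; norm_num
  choose f hfcard hf using fun i => hD.exists_cover hR (c i) p
  have hYcard : (Finset.univ.biUnion f).card ≤ (k + z) * 2 ^ (D * p) := by
    simpa using Finset.card_biUnion_le_card_mul Finset.univ f _ fun i _ => hfcard i
  have hmain := ht.radius_le (δ := εh / 2 * R) (by positivity) hYcard fun x hx => by
    obtain ⟨i, hi⟩ := hcov x hx
    obtain ⟨y, hy, hxy⟩ := hf i x hi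
    exact ⟨y, Finset.mem_biUnion.2 ⟨i, Finset.mem_univ i, hy⟩, hxy.trans hRp⟩
  exact ⟨hmain, _, min_le_left _ _, hmain⟩
end
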